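/- Let E be a reflexive Banach space and let Ψ, Φ : E → ℝ be C¹ functionals satisfying (Ψ1)–(Ψ4) and (Φ1)–(Φ3) (but not necessarily (Ψ5)). Then for every r₀ > 0 the function φ(r) = max_{u ∈ ∂Ã_r} Φ(u) has a right-hand derivative at r₀ with φ'₊(r₀) = max_{u ∈ G_{r₀}} Φ'(u)u / Ψ'(u)u, and moreover limsup_{r → 0⁻} (φ(r₀ + r) − φ(r₀))/r ≤ max_{u ∈ G_{r₀}} Φ'(u)u / Ψ'(u)u. -/

import Mathlib

open Filter Topology Set

variable {E : Type*}

/-- Weak (sequential) convergence in a normed space: `u n ⇀ u₀` iff `f (u n) → f u₀`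
for every continuous linear functional `f`. -/
def WeakConv [NormedAddCommGroup E] [NormedSpace ℝ E] (u : ℕ → E) (u₀ : E) : Prop :=
  ∀ f : E →L[ℝ] ℝ, Tendsto (fun n => f (u n)) atTop (𝓝 (f u₀))

/-- In a reflexive space, bounded sequences have weakly convergent subsequences. -/
theorem exists_weakConv_subseq [NormedAddCommGroup E] [NormedSpace ℝ E]
    (hrefl : Function.Surjective (NormedSpace.inclusionInDoubleDual ℝ E))
    {u : ℕ → E} (hu : Bornology.IsBounded (range u)) :
    ∃ (x : E) (φ : ℕ → ℕ), StrictMono φ ∧ WeakConv (u ∘ φ) x := by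
  let M : Submodule ℝ E := (Submodule.span ℝ (range u)).topologicalClosure
  have hMsep : TopologicalSpace.IsSeparable (M : Set E) :=
    ((countable_range u).isSeparable.span).closure
  have huM : ∀ n, u n ∈ M := fun n =>
    Submodule.le_topologicalClosure _ (Submodule.subset_span (mem_range_self n))
  let K : Set (WeakSpace ℝ E) :=
    closure (toWeakSpace ℝ E '' range u) ∩ toWeakSpace ℝ E '' (M : Set E)
  have hMclosed : IsClosed (toWeakSpace ℝ E '' (M : Set E)) := by
    have h := Convex.toWeakSpace_closure (𝕜 := ℝ) M.convex
    rw [(Submodule.isClosed_topologicalClosure _ : IsClosed (M : Set E)).closure_eq] at h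
    rw [h]
    exact isClosed_closure
  have hK : IsCompact K := by
    refine IsCompact.inter_right
      (NormedSpace.isCompact_closure_of_isBounded ℝ E _ ?_ ?_) hMclosed
    · rwa [preimage_image_eq _ (toWeakSpace ℝ E).injective]
    · intro y _
      obtain ⟨x, hx⟩ := hrefl (WeakDual.toStrongDual y)
      refine ⟨toWeakSpace ℝ E x, ?_⟩
      apply DFunLike.ext
      intro f
      exact DFunLike.congr_fun hx f
  have huK : ∀ n, toWeakSpace ℝ E (u n) ∈ K := fun n =>
    ⟨subset_closure (mem_image_of_mem _ (mem_range_self n)), mem_image_of_mem _ (huM n)⟩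
  have hcont : ∀ f : E →L[ℝ] ℝ,
      Continuous fun x : WeakSpace ℝ E => f ((toWeakSpace ℝ E).symm x) := fun f =>
    WeakBilin.eval_continuous (topDualPairing ℝ E).flip f
  obtain ⟨D, hDc, hDM⟩ := hMsep
  have hDne : D.Nonempty := by
    rw [← closure_nonempty_iff]
    exact ⟨u 0, hDM (huM 0)⟩
  obtain ⟨d, hd⟩ := hDc.exists_eq_range hDne
  choose g hg1 hg2 using fun n => exists_dual_vector'' ℝ (d n)
  have : CompactSpace K := isCompact_iff_compactSpace.mp hK
  have : TopologicalSpace.MetrizableSpace K := by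
    refine Metric.PiNatEmbed.TopologicalSpace.MetrizableSpace.of_countable_separating
      (fun n (k : K) => g n ((toWeakSpace ℝ E).symm k))
      (fun n => (hcont (g n)).comp continuous_subtype_val) ?_
    rintro ⟨_, _, x, hx, rfl⟩ ⟨_, _, y, hy, rfl⟩ hxy
    have hne : x - y ≠ 0 := by
      intro h
      exact hxy (Subtype.ext (congrArg (toWeakSpace ℝ E) (sub_eq_zero.mp h)))
    have hpos : 0 < ‖x - y‖ := norm_pos_iff.mpr hne
    obtain ⟨z, hz, hxz⟩ := Metric.mem_closure_iff.mp (hDM (M.sub_mem hx hy)) (‖x - y‖ / 2)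
      (by positivity)
    rw [hd] at hz
    obtain ⟨n, rfl⟩ := hz
    refine ⟨n, fun heq => ?_⟩
    simp only [LinearEquiv.symm_apply_apply] at heq
    have h0 : g n (x - y) = 0 := by rw [map_sub, heq, sub_self]
    have h1 : ‖g n (x - y - d n)‖ ≤ 1 * ‖x - y - d n‖ := (g n).le_of_opNorm_le (hg1 n) _
    rw [map_sub, h0, hg2, Real.norm_eq_abs] at h1
    have h2 := neg_abs_le (0 - (‖d n‖ : ℝ))
    have h3 := norm_sub_norm_le (x - y) (d n)
    rw [dist_eq_norm] at hxz
    simp only [RCLike.ofReal_real_eq_id, id_eq] at h1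
    linarith
  have : SeqCompactSpace K := by
    let := TopologicalSpace.metrizableSpaceMetric K
    infer_instance
  obtain ⟨⟨x, hx⟩, φ, hφ, hlim⟩ :=
    SeqCompactSpace.tendsto_subseq (fun n => (⟨_, huK n⟩ : K))
  refine ⟨(toWeakSpace ℝ E).symm x, φ, hφ, fun f => ?_⟩
  have := (((hcont f).comp continuous_subtype_val).tendsto (⟨x, hx⟩ : K)).comp hlim
  exact this

theorem WeakConv.smul [NormedAddCommGroup E] [NormedSpace ℝ E] {u : ℕ → E} {u₀ : E}
    (hu : WeakConv u u₀) {c : ℕ → ℝ} (hc : Tendsto c atTop (𝓝 1)) :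
    WeakConv (fun n => c n • u n) u₀ := by
  intro f
  simpa using hc.mul (hu f)

/-- A sequentially weakly upper semicontinuous function attains its maximum on a nonempty
sequentially weakly compact set. -/
theorem exists_forall_le_of_weakConv [NormedAddCommGroup E] [NormedSpace ℝ E]
    {S : Set E} {f : E → ℝ} (hne : S.Nonempty)
    (hS : ∀ u : ℕ → E, (∀ n, u n ∈ S) →
      ∃ x ∈ S, ∃ φ : ℕ → ℕ, StrictMono φ ∧ WeakConv (u ∘ φ) x)
    (hf : ∀ (u : ℕ → E) (x : E), (∀ n, u n ∈ S) → x ∈ S → WeakConv u x →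
      ∀ ε > (0:ℝ), ∀ᶠ n in atTop, f (u n) < f x + ε) :
    ∃ x ∈ S, ∀ v ∈ S, f v ≤ f x := by
  have hbdd : BddAbove (f '' S) := by
    by_contra h
    have h' : ∀ n : ℕ, ∃ x ∈ S, (n : ℝ) < f x := by
      intro n
      obtain ⟨_, ⟨x, hx, rfl⟩, hlt⟩ := not_bddAbove_iff.mp h n
      exact ⟨x, hx, hlt⟩
    choose u huS hu using h'
    obtain ⟨x, hx, φ, hφ, hlim⟩ := hS u huS
    have h1 := hf _ x (fun n => huS (φ n)) hx hlim 1 one_pos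
    have h2 := (tendsto_natCast_atTop_atTop (R := ℝ)).comp hφ.tendsto_atTop
      |>.eventually_ge_atTop (f x + 1)
    obtain ⟨n, hn1, hn2⟩ := (h1.and h2).exists
    have := hu (φ n)
    simp only [Function.comp_apply] at hn1 hn2
    linarith
  obtain ⟨y, -, hy, hyS⟩ := exists_seq_tendsto_sSup (hne.image f) hbdd
  choose u huS hu using hyS
  obtain ⟨x, hx, φ, hφ, hlim⟩ := hS u huS
  refine ⟨x, hx, fun v hv => (le_csSup hbdd (mem_image_of_mem f hv)).trans ?_⟩
  refine le_of_forall_pos_le_add fun ε hε => ?_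
  refine le_of_tendsto (hy.comp hφ.tendsto_atTop) ?_
  filter_upwards [hf _ x (fun n => huS (φ n)) hx hlim ε hε] with n hn
  exact (hu (φ n)).symm.le.trans hn.le

theorem ConvexOn.map_smul_le_of_map_zero [AddCommGroup E] [Module ℝ E] {Ψ : E → ℝ}
    (hΨ : ConvexOn ℝ univ Ψ) (h0 : Ψ 0 = 0) (u : E) {t : ℝ} (ht0 : 0 ≤ t) (ht1 : t ≤ 1) :
    Ψ (t • u) ≤ t * Ψ u := by
  have := hΨ.2 (mem_univ u) (mem_univ 0) ht0 (sub_nonneg.mpr ht1) (by ring)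
  simpa [h0] using this

/-- The dilation factor between two levels of a convex function vanishing at the origin is
controlled by the levels. -/
theorem ConvexOn.abs_sub_one_le_of_map_smul_eq [AddCommGroup E] [Module ℝ E] {Ψ : E → ℝ}
    (hΨ : ConvexOn ℝ univ Ψ) (h0 : Ψ 0 = 0) {u : E} {r s t : ℝ} (hr : 0 < r)
    (hu : Ψ u = r) (ht : 0 < t) (hts : Ψ (t • u) = s) : |t - 1| ≤ |s - r| / r := by
  rw [le_div_iff₀ hr]
  rcases le_total t 1 with h | h
  · have h1 := hΨ.map_smul_le_of_map_zero h0 u ht.le h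
    rw [hts, hu] at h1
    rw [abs_of_nonpos (by linarith), abs_of_nonpos (by nlinarith)]
    linarith
  · have h1 := hΨ.map_smul_le_of_map_zero h0 (t • u) (inv_nonneg.mpr ht.le) (inv_le_one_of_one_le₀ h)
    rw [inv_smul_smul₀ ht.ne', hts, hu, inv_mul_eq_div, le_div_iff₀ ht] at h1
    rw [abs_of_nonneg (by linarith), abs_of_nonneg (by nlinarith)]
    linarith

theorem Differentiable.hasDerivAt_comp_smul [NormedAddCommGroup E] [NormedSpace ℝ E]
    {F : E → ℝ} (hF : Differentiable ℝ F) (u : E) (t : ℝ) :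
    HasDerivAt (fun t : ℝ => F (t • u)) (fderiv ℝ F (t • u) u) t := by
  have h := (hasDerivAt_id t).smul_const u
  rw [one_smul] at h
  exact (hF (t • u)).hasFDerivAt.comp_hasDerivAt t h

/-- Along the ray through `u`, parametrised by the values of `Ψ`, the difference quotients
of `Φ` converge to `Φ'(u)u / Ψ'(u)u`. -/
theorem exists_ray_tendsto [NormedAddCommGroup E] [NormedSpace ℝ E] {Ψ Φ : E → ℝ}
    (hΨd : Differentiable ℝ Ψ) (hΦd : Differentiable ℝ Φ) (hΨ : ConvexOn ℝ univ Ψ)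
    (h0 : Ψ 0 = 0) {u : E} {r : ℝ} (hr : 0 < r) (hu : Ψ u = r)
    (hΨ' : fderiv ℝ Ψ u u ≠ 0)
    (hray : ∀ s > (0:ℝ), ∃ t : ℝ, 0 < t ∧ Ψ (t • u) = s) :
    ∃ w : ℝ → E, (∀ s > 0, Ψ (w s) = s) ∧
      Tendsto (fun s => (Φ (w s) - Φ u) / (s - r)) (𝓝[≠] r)
        (𝓝 (fderiv ℝ Φ u u / fderiv ℝ Ψ u u)) := by
  have hray' : ∀ s : ℝ, ∃ t : ℝ, 0 < s → 0 < t ∧ Ψ (t • u) = s := by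
    intro s
    by_cases hs : 0 < s
    · obtain ⟨t, ht⟩ := hray s hs
      exact ⟨t, fun _ => ht⟩
    · exact ⟨0, fun h => absurd h hs⟩
  choose t ht using hray'
  refine ⟨fun s => t s • u, fun s hs => (ht s hs).2, ?_⟩
  have hpos : ∀ᶠ s in 𝓝[≠] r, 0 < s := nhdsWithin_le_nhds (lt_mem_nhds hr)
  have htlim : Tendsto t (𝓝[≠] r) (𝓝[≠] 1) := by
    refine tendsto_nhdsWithin_iff.mpr ⟨?_, ?_⟩
    · rw [tendsto_iff_dist_tendsto_zero]
      have hb : Tendsto (fun s : ℝ => |s - r| / r) (𝓝[≠] r) (𝓝 0) := by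
        have : Continuous fun s : ℝ => |s - r| / r := by fun_prop
        simpa using (this.tendsto r).mono_left nhdsWithin_le_nhds
      refine squeeze_zero' (Eventually.of_forall fun _ => dist_nonneg) ?_ hb
      filter_upwards [hpos] with s hs
      exact hΨ.abs_sub_one_le_of_map_smul_eq h0 hr hu (ht s hs).1 (ht s hs).2
    · filter_upwards [hpos, self_mem_nhdsWithin] with s hs hsr h
      apply hsr
      have h2 := (ht s hs).2
      rw [mem_singleton_iff.mp h, one_smul, hu] at h2
      exact h2.symm
  have hΦ1 := hΦd.hasDerivAt_comp_smul u 1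
  have hΨ1 := hΨd.hasDerivAt_comp_smul u 1
  rw [one_smul] at hΦ1 hΨ1
  have hlim := ((hasDerivAt_iff_tendsto_slope.mp hΦ1).div
    (hasDerivAt_iff_tendsto_slope.mp hΨ1) hΨ').comp htlim
  refine hlim.congr' ?_
  filter_upwards [hpos, htlim self_mem_nhdsWithin] with s hs hs1
  have hs1ne : t s - 1 ≠ 0 := sub_ne_zero.mpr hs1
  simp only [Function.comp_apply, Pi.div_apply, slope_def_field, one_smul, (ht s hs).2, hu]
  rw [div_div_div_cancel_right₀ hs1ne]

/-- Cauchy's mean value theorem along a ray. -/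
theorem exists_smul_ratio_eq [NormedAddCommGroup E] [NormedSpace ℝ E] {Ψ Φ : E → ℝ}
    (hΨd : Differentiable ℝ Ψ) (hΦd : Differentiable ℝ Φ) {u : E} {θ : ℝ}
    (hθ1 : θ < 1) (hΨne : Ψ (θ • u) ≠ Ψ u)
    (hΨ' : ∀ c ∈ Ioo θ 1, fderiv ℝ Ψ (c • u) (c • u) ≠ 0) :
    ∃ c ∈ Ioo θ 1, (Φ u - Φ (θ • u)) / (Ψ u - Ψ (θ • u)) =
      fderiv ℝ Φ (c • u) (c • u) / fderiv ℝ Ψ (c • u) (c • u) := by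
  obtain ⟨c, hc, h⟩ := exists_ratio_hasDerivAt_eq_ratio_slope (fun t : ℝ => Φ (t • u))
    (fun t => fderiv ℝ Φ (t • u) u) hθ1
    (fun t _ => (hΦd.hasDerivAt_comp_smul u t).continuousAt.continuousWithinAt)
    (fun t _ => hΦd.hasDerivAt_comp_smul u t) (fun t : ℝ => Ψ (t • u))
    (fun t => fderiv ℝ Ψ (t • u) u)
    (fun t _ => (hΨd.hasDerivAt_comp_smul u t).continuousAt.continuousWithinAt)
    (fun t _ => hΨd.hasDerivAt_comp_smul u t)
  refine ⟨c, hc, ?_⟩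
  simp only [one_smul] at h
  rw [div_eq_div_iff (sub_ne_zero.mpr hΨne.symm) (hΨ' c hc), map_smul, map_smul, smul_eq_mul,
    smul_eq_mul]
  linear_combination -c * h

/-- Weak limits of maximizers over shrinking sublevel sets are maximizers, provided the maximal
values dominate those of the limiting sublevel set. -/
theorem isMax_of_weakConv [NormedAddCommGroup E] [NormedSpace ℝ E] {Ψ Φ : E → ℝ}
    (hΨwlsc : ∀ (u : ℕ → E) (u₀ : E), WeakConv u u₀ →
      ∀ ε > (0:ℝ), ∀ᶠ n in atTop, Ψ u₀ - ε < Ψ (u n))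
    (hΦwusc : ∀ (u : ℕ → E) (u₀ : E), WeakConv u u₀ →
      ∀ ε > (0:ℝ), ∀ᶠ n in atTop, Φ (u n) < Φ u₀ + ε)
    {r : ℝ} {s : ℕ → ℝ} (hs : Tendsto s atTop (𝓝 r)) {u : ℕ → E} {x : E}
    (hu : ∀ n, Ψ (u n) ≤ s n) (hmax : ∀ n v, Ψ v ≤ r → Φ v ≤ Φ (u n)) (hlim : WeakConv u x) :
    Ψ x ≤ r ∧ ∀ v, Ψ v ≤ r → Φ v ≤ Φ x := by
  refine ⟨le_of_forall_pos_le_add fun ε hε => ?_, fun v hv =>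
    le_of_forall_pos_le_add fun ε hε => ?_⟩
  · have h : Ψ x - ε ≤ r := by
      refine ge_of_tendsto hs ?_
      filter_upwards [hΨwlsc u x hlim ε hε] with n hn
      exact hn.le.trans (hu n)
    linarith
  · obtain ⟨n, hn⟩ := (hΦwusc u x hlim ε hε).exists
    exact (hmax n v hv).trans hn.le

/-- Without (Ψ5), `φ` still has a right-hand derivative at every `r₀ > 0`, equal to
`max_(u ∈ G_(r₀)) Φ'(u)u / Ψ'(u)u`, and the left difference quotients satisfy the
corresponding `limsup` inequality. -/
theorem varphi_right_derivative [NormedAddCommGroup E] [NormedSpace ℝ E] [CompleteSpace E]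
    (hrefl : Function.Surjective (NormedSpace.inclusionInDoubleDual ℝ E))
    (Ψ Φ : E → ℝ) (hΨC1 : ContDiff ℝ 1 Ψ) (hΦC1 : ContDiff ℝ 1 Φ)
    -- (Ψ1): Ψ is convex, coercive and weakly (sequentially) lower semicontinuous
    (hΨconv : ConvexOn ℝ Set.univ Ψ)
    (hΨcoer : Tendsto Ψ (Bornology.cobounded E) atTop)
    (hΨwlsc : ∀ (u : ℕ → E) (u₀ : E), WeakConv u u₀ →
      ∀ ε > (0:ℝ), ∀ᶠ n in atTop, Ψ u₀ - ε < Ψ (u n))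
    -- (Ψ2): Ã₀ = {0} and 0 ∈ int Ã_r for every r > 0
    (hΨ2a : {u : E | Ψ u ≤ 0} = {0})
    (hΨ2b : ∀ r > (0:ℝ), (0:E) ∈ interior {u : E | Ψ u ≤ r})
    -- (Ψ3): Ψ'(u)u ≠ 0 on every boundary ∂Ã_r, r > 0
    (hΨ3 : ∀ r > (0:ℝ), ∀ u : E, Ψ u = r → fderiv ℝ Ψ u u ≠ 0)
    -- (Ψ4): for every u ≠ 0 and r > 0 there is a unique t > 0 with t • u ∈ ∂Ã_r
    (hΨ4 : ∀ u : E, u ≠ 0 → ∀ r > (0:ℝ), ∃! t : ℝ, 0 < t ∧ Ψ (t • u) = r)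
    -- Φ is weakly (sequentially) upper semicontinuous
    (hΦwusc : ∀ (u : ℕ → E) (u₀ : E), WeakConv u u₀ →
      ∀ ε > (0:ℝ), ∀ᶠ n in atTop, Φ (u n) < Φ u₀ + ε)
    -- (Φ1), second part: u ↦ Φ'(u)u/Ψ'(u)u is weakly (sequentially) upper
    -- semicontinuous on E ∖ {0}
    (hQwusc : ∀ (u : ℕ → E) (u₀ : E), u₀ ≠ 0 → (∀ n, u n ≠ 0) → WeakConv u u₀ →
      ∀ ε > (0:ℝ), ∀ᶠ n in atTop,
        fderiv ℝ Φ (u n) (u n) / fderiv ℝ Ψ (u n) (u n) <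
          fderiv ℝ Φ u₀ u₀ / fderiv ℝ Ψ u₀ u₀ + ε)
    -- (Φ2): critical points of Φ have nonpositive Φ-value
    (hΦ2 : ∀ u : E, fderiv ℝ Φ u = 0 → Φ u ≤ 0)
    -- (Φ3): there is a sequence vₙ → 0 with Φ(vₙ) > 0
    (hΦ3 : ∃ v : ℕ → E, Tendsto v atTop (𝓝 0) ∧ ∀ n, 0 < Φ (v n))
    :
    ∀ r₀ > (0:ℝ),
      HasDerivWithinAt (fun s : ℝ => sSup (Φ '' {u : E | Ψ u = s}))
        (sSup ((fun u : E => fderiv ℝ Φ u u / fderiv ℝ Ψ u u) ''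
          {u : E | Ψ u ≤ r₀ ∧ ∀ v : E, Ψ v ≤ r₀ → Φ v ≤ Φ u})) (Set.Ici r₀) r₀ ∧
      ∀ ε > (0:ℝ), ∀ᶠ r in nhdsWithin (0:ℝ) (Set.Iio 0),
        (sSup (Φ '' {u : E | Ψ u = r₀ + r}) - sSup (Φ '' {u : E | Ψ u = r₀})) / r <
          sSup ((fun u : E => fderiv ℝ Φ u u / fderiv ℝ Ψ u u) ''
            {u : E | Ψ u ≤ r₀ ∧ ∀ v : E, Ψ v ≤ r₀ → Φ v ≤ Φ u}) + ε := by
  have hΨd : Differentiable ℝ Ψ := hΨC1.differentiable one_ne_zero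
  have hΦd : Differentiable ℝ Φ := hΦC1.differentiable one_ne_zero
  obtain ⟨v, hv0, hvpos⟩ := hΦ3
  have hΨ0le : Ψ 0 ≤ 0 := by
    have : (0:E) ∈ {u : E | Ψ u ≤ 0} := by rw [hΨ2a]; rfl
    exact this
  have hΨ0 : Ψ 0 = 0 := by
    refine le_antisymm hΨ0le (not_lt.mp fun hlt => ?_)
    have hev : ∀ᶠ x in 𝓝 (0:E), x = 0 := by
      filter_upwards [hΨd.continuous.continuousAt.eventually_lt_const hlt] with x hx
      have : x ∈ {u : E | Ψ u ≤ 0} := hx.le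
      rwa [hΨ2a] at this
    obtain ⟨n, hn⟩ := (hv0.eventually hev).exists
    have hloc : IsLocalMax Φ 0 := hev.mono fun x hx => by rw [hx]
    have h1 := hΦ2 0 hloc.fderiv_eq_zero
    have h2 := hvpos n
    rw [hn] at h2
    exact absurd h1 (not_le.mpr h2)
  have hΨpos : ∀ x : E, x ≠ 0 → 0 < Ψ x := by
    intro x hx
    by_contra h
    have : x ∈ {u : E | Ψ u ≤ 0} := not_lt.mp h
    rw [hΨ2a] at this
    exact hx this
  have hΨ' : ∀ x : E, x ≠ 0 → fderiv ℝ Ψ x x ≠ 0 := fun x hx => hΨ3 _ (hΨpos x hx) x rfl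
  have hray : ∀ u : E, u ≠ 0 → ∀ s > (0:ℝ), ∃ t : ℝ, 0 < t ∧ Ψ (t • u) = s := fun u hu s hs =>
    (hΨ4 u hu s hs).exists
  have hsub : ∀ (R : ℝ) (u : ℕ → E), (∀ n, Ψ (u n) ≤ R) →
      ∃ (x : E) (φ : ℕ → ℕ), StrictMono φ ∧ WeakConv (u ∘ φ) x := by
    intro R u hu
    refine exists_weakConv_subseq hrefl ?_
    have hb : Bornology.IsBounded {x : E | Ψ x ≤ R} := by
      rw [← Bornology.isCobounded_compl_iff, Bornology.isCobounded_def]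
      filter_upwards [hΨcoer.eventually_gt_atTop R] with x hx
      exact not_le.mpr hx
    exact hb.subset (range_subset_iff.mpr hu)
  let G : ℝ → Set E := fun r => {u : E | Ψ u ≤ r ∧ ∀ v : E, Ψ v ≤ r → Φ v ≤ Φ u}
  let φ : ℝ → ℝ := fun s => sSup (Φ '' {u : E | Ψ u = s})
  let Q : E → ℝ := fun u => fderiv ℝ Φ u u / fderiv ℝ Ψ u u
  have hGne : ∀ r > 0, (G r).Nonempty := by
    intro r hr
    obtain ⟨x, hx, hmax⟩ := exists_forall_le_of_weakConv (S := {u : E | Ψ u ≤ r}) (f := Φ)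
      ⟨0, hΨ0le.trans hr.le⟩
      (fun u hu => by
        obtain ⟨x, ψ, hψ, hlim⟩ := hsub r u hu
        refine ⟨x, show Ψ x ≤ r from ?_, ψ, hψ, hlim⟩
        refine le_of_forall_pos_le_add fun ε hε => ?_
        obtain ⟨n, hn⟩ := (hΨwlsc _ x hlim ε hε).exists
        have h1 : Ψ (u (ψ n)) ≤ r := hu (ψ n)
        simp only [Function.comp_apply] at hn
        linarith)
      (fun u x _ _ => hΦwusc u x)
    exact ⟨x, hx, hmax⟩
  have hGeq : ∀ r > 0, ∀ u ∈ G r, Ψ u = r := by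
    rintro r hr u ⟨hur, hmax⟩
    refine le_antisymm hur (not_lt.mp fun hlt => ?_)
    have hloc : IsLocalMax Φ u := by
      filter_upwards [hΨd.continuous.continuousAt.eventually_lt_const hlt] with x hx
      exact hmax x hx.le
    have h1 := hΦ2 u hloc.fderiv_eq_zero
    obtain ⟨n, hn⟩ := (hv0.eventually (mem_interior_iff_mem_nhds.mp (hΨ2b r hr))).exists
    exact absurd ((hvpos n).trans_le (hmax _ hn)) (not_lt.mpr h1)
  have hφG : ∀ r > 0, ∀ u ∈ G r, φ r = Φ u := by
    intro r hr u hu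
    refine IsGreatest.csSup_eq ⟨mem_image_of_mem Φ (hGeq r hr u hu), ?_⟩
    rintro _ ⟨w, hw, rfl⟩
    exact hu.2 w (le_of_eq hw)
  have hφle : ∀ r > 0, ∀ w, Ψ w ≤ r → Φ w ≤ φ r := by
    intro r hr w hw
    obtain ⟨u, hu⟩ := hGne r hr
    rw [hφG r hr u hu]
    exact hu.2 w hw
  have hne0 : ∀ r > 0, ∀ u : E, Ψ u = r → u ≠ 0 := by
    rintro r hr u hu rfl
    exact hr.ne (hΨ0.symm.trans hu)
  intro r₀ hr₀
  obtain ⟨u₀, hu₀, hQmax⟩ := exists_forall_le_of_weakConv (S := G r₀) (f := Q) (hGne r₀ hr₀)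
    (fun u hu => by
      obtain ⟨x, ψ, hψ, hlim⟩ := hsub r₀ u fun n => (hu n).1
      exact ⟨x, isMax_of_weakConv hΨwlsc hΦwusc tendsto_const_nhds
        (fun n => (hu (ψ n)).1) (fun n => (hu (ψ n)).2) hlim, ψ, hψ, hlim⟩)
    (fun u x hu hx hlim => hQwusc u x (hne0 r₀ hr₀ x (hGeq r₀ hr₀ x hx))
      (fun n => hne0 r₀ hr₀ _ (hGeq r₀ hr₀ _ (hu n))) hlim)
  have hm : sSup (Q '' G r₀) = Q u₀ := by
    refine IsGreatest.csSup_eq ⟨mem_image_of_mem Q hu₀, ?_⟩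
    rintro _ ⟨w, hw, rfl⟩
    exact hQmax w hw
  have hΨu₀ := hGeq r₀ hr₀ u₀ hu₀
  have hu₀ne := hne0 r₀ hr₀ u₀ hΨu₀
  obtain ⟨w, hwΨ, hwlim⟩ := exists_ray_tendsto hΨd hΦd hΨconv hΨ0 hr₀ hΨu₀
    (hΨ' u₀ hu₀ne) (hray u₀ hu₀ne)
  have hpos : ∀ᶠ s in 𝓝 r₀, 0 < s := lt_mem_nhds hr₀
  have hupper : ∀ ε > 0, ∀ᶠ s in 𝓝[>] r₀, (φ s - φ r₀) / (s - r₀) < Q u₀ + ε := by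
    intro ε hε
    by_contra hcon
    have hfreq := (not_eventually.mp hcon).and_eventually self_mem_nhdsWithin
    obtain ⟨s, hs, hsp⟩ := exists_seq_forall_of_frequently hfreq
    have hs' : Tendsto s atTop (𝓝 r₀) := hs.mono_right nhdsWithin_le_nhds
    have hs0 : ∀ n, r₀ < s n := fun n => (hsp n).2
    have hspos : ∀ n, 0 < s n := fun n => hr₀.trans (hs0 n)
    choose u hu using fun n => hGne (s n) (hspos n)
    have huΨ : ∀ n, Ψ (u n) = s n := fun n => hGeq _ (hspos n) _ (hu n)
    have hune : ∀ n, u n ≠ 0 := fun n => hne0 _ (hspos n) _ (huΨ n)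
    have hc : ∀ n, ∃ c : ℝ, 0 < c ∧ c < 1 ∧ 1 - c ≤ (s n - r₀) / s n ∧
        (φ (s n) - φ r₀) / (s n - r₀) ≤ Q (c • u n) := by
      intro n
      obtain ⟨θ, hθ0, hθ⟩ := hray (u n) (hune n) r₀ hr₀
      have habs := hΨconv.abs_sub_one_le_of_map_smul_eq hΨ0 (hspos n) (huΨ n) hθ0 hθ
      have hθ1 : θ < 1 := by
        by_contra hge
        have hge : 1 ≤ θ := not_lt.mp hge
        have h1 := hΨconv.map_smul_le_of_map_zero hΨ0 (θ • u n) (inv_nonneg.mpr hθ0.le)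
          (inv_le_one_of_one_le₀ hge)
        rw [inv_smul_smul₀ hθ0.ne', huΨ, hθ] at h1
        have := mul_le_mul_of_nonneg_right (inv_le_one_of_one_le₀ hge) hr₀.le
        linarith [hs0 n]
      obtain ⟨c, hc, hceq⟩ := exists_smul_ratio_eq hΨd hΦd (u := u n) hθ1
        (by rw [hθ, huΨ]; exact (hs0 n).ne)
        (fun c hc => hΨ' _ (smul_ne_zero (hθ0.trans hc.1).ne' (hune n)))
      refine ⟨c, hθ0.trans hc.1, hc.2, ?_, ?_⟩
      · rw [abs_sub_comm, abs_of_pos (sub_pos.mpr hθ1), abs_sub_comm,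
          abs_of_pos (sub_pos.mpr (hs0 n))] at habs
        linarith [hc.1]
      · change _ ≤ fderiv ℝ Φ (c • u n) (c • u n) / fderiv ℝ Ψ (c • u n) (c • u n)
        rw [← hceq, huΨ, hθ, hφG _ (hspos n) _ (hu n)]
        have := hφle r₀ hr₀ (θ • u n) hθ.le
        have := sub_pos.mpr (hs0 n)
        gcongr
    choose c hc0 hc1 hcs hcQ using hc
    have hclim : Tendsto c atTop (𝓝 1) := by
      have h1 : Tendsto (fun n => 1 - (s n - r₀) / s n) atTop (𝓝 1) := by
        have := (tendsto_const_nhds (x := (1:ℝ))).sub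
          ((hs'.sub (tendsto_const_nhds (x := r₀))).div hs' hr₀.ne')
        simpa using this
      exact tendsto_of_tendsto_of_tendsto_of_le_of_le h1 tendsto_const_nhds
        (fun n => by have := hcs n; simp only; linarith) (fun n => (hc1 n).le)
    obtain ⟨B, hB⟩ := hs'.bddAbove_range
    obtain ⟨x, ψ, hψ, hlim⟩ := hsub B u fun n => (huΨ n).le.trans (hB (mem_range_self n))
    have hxG : x ∈ G r₀ := isMax_of_weakConv hΨwlsc hΦwusc (hs'.comp hψ.tendsto_atTop)
      (fun n => (hu (ψ n)).1)
      (fun n v hv => (hu (ψ n)).2 v (hv.trans (hs0 (ψ n)).le)) hlim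
    have hlim' := hlim.smul (hclim.comp hψ.tendsto_atTop)
    obtain ⟨n, hn⟩ := (hQwusc _ x (hne0 r₀ hr₀ x (hGeq r₀ hr₀ x hxG))
      (fun n => smul_ne_zero (hc0 (ψ n)).ne' (hune (ψ n))) hlim' ε hε).exists
    have h1 := hcQ (ψ n)
    have h2 := (hsp (ψ n)).1
    have h3 := hQmax x hxG
    change Q (c (ψ n) • u (ψ n)) < Q x + ε at hn
    linarith [not_lt.mp h2]
  change HasDerivWithinAt φ (sSup (Q '' G r₀)) (Ici r₀) r₀ ∧
    ∀ ε > (0:ℝ), ∀ᶠ r in 𝓝[<] 0, (φ (r₀ + r) - φ r₀) / r < sSup (Q '' G r₀) + ε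
  rw [hm]
  have hφr₀ := hφG r₀ hr₀ u₀ hu₀
  constructor
  · rw [← hasDerivWithinAt_Ioi_iff_Ici, hasDerivWithinAt_iff_tendsto_slope' (notMem_Ioi.mpr le_rfl)]
    rw [tendsto_order]
    constructor
    · intro a ha
      have hlow := (hwlim.mono_left (nhdsWithin_mono r₀ fun s (hs : r₀ < s) => hs.ne')).eventually
        (lt_mem_nhds ha)
      filter_upwards [hlow, self_mem_nhdsWithin] with s hs hsr
      have hsr : r₀ < s := hsr
      have hs0 : 0 < s := hr₀.trans hsr
      rw [slope_def_field]
      refine hs.trans_le ?_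
      have := hφle s hs0 (w s) (hwΨ s hs0).le
      have := sub_pos.mpr hsr
      rw [hφr₀]
      gcongr
    · intro a ha
      filter_upwards [hupper (a - Q u₀) (sub_pos.mpr ha)] with s hs
      rw [slope_def_field]
      linarith
  · intro ε hε
    have hleft : ∀ᶠ s in 𝓝[<] r₀, (φ s - φ r₀) / (s - r₀) < Q u₀ + ε := by
      have hup := (hwlim.mono_left (nhdsWithin_mono r₀ fun s (hs : s < r₀) => hs.ne)).eventually
        (gt_mem_nhds (lt_add_of_pos_right (Q u₀) hε))
      filter_upwards [hup, self_mem_nhdsWithin, nhdsWithin_le_nhds hpos] with s hs hsr hs0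
      have hsr : s < r₀ := hsr
      refine lt_of_le_of_lt ?_ hs
      have := hφle s hs0 (w s) (hwΨ s hs0).le
      rw [hφr₀]
      exact div_le_div_of_nonpos_of_le (sub_nonpos.mpr hsr.le) (by linarith)
    have hshift : Tendsto (fun r : ℝ => r₀ + r) (𝓝[<] 0) (𝓝[<] r₀) := by
      refine tendsto_nhdsWithin_iff.mpr ⟨?_, ?_⟩
      · have : Continuous fun r : ℝ => r₀ + r := by fun_prop
        simpa using (this.tendsto 0).mono_left nhdsWithin_le_nhds
      · filter_upwards [self_mem_nhdsWithin] with r hr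
        have hr : r < 0 := hr
        exact show r₀ + r < r₀ by linarith
    filter_upwards [hshift.eventually hleft] with r hr
    simpa using hr
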